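/- Let n ≥ 2 and let Y be an unbounded closed subset of ℝ^{n+1}. Then the normed space (𝔜(Y), ‖·‖_𝔜) is separable. -/

import Mathlib

/- Function spaces 𝔚, 𝔛, 𝔜′, 𝔜₀, 𝔜 on `Y × 𝕊ⁿ` from Bernstein–Wang,
"A mountain-pass theorem for asymptotically conical self-expanders". -/

noncomputable section

open Set Metric Real Filter
open scoped RealInnerProductSpace

/-- `ℝ^{n+1}` as a Euclidean space. -/
abbrev Euc (n : ℕ) : Type := EuclideanSpace ℝ (Fin (n + 1))

/-- The unit sphere `𝕊ⁿ ⊆ ℝ^{n+1}`. -/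
def Sph (n : ℕ) : Set (Euc n) := Metric.sphere (0 : Euc n) 1

/-- The set `Y × 𝕊ⁿ` inside `ℝ^{n+1} × ℝ^{n+1}`. -/
def pts {n : ℕ} (Y : Set (Euc n)) : Set (Euc n × Euc n) := Y ×ˢ Sph n

/-- The weight `(1+|p|)^{n+1} e^{|p|²/4}` appearing in the 𝔚-norm. -/
def wWeight (n : ℕ) (p : Euc n) : ℝ := (1 + ‖p‖) ^ (n + 1) * Real.exp (‖p‖ ^ 2 / 4)

/-- The 𝔚-norm `sup (1+|p|)^{n+1} e^{|p|²/4} |ψ|` over `Y × 𝕊ⁿ`. -/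
def WNorm {n : ℕ} (Y : Set (Euc n)) (ψ : Euc n × Euc n → ℝ) : ℝ :=
  sSup ((fun x => wWeight n x.1 * |ψ x|) '' pts Y)

/-- Membership in the space 𝔚(Y) of rapidly decaying continuous functions. -/
def memW {n : ℕ} (Y : Set (Euc n)) (ψ : Euc n × Euc n → ℝ) : Prop :=
  ContinuousOn ψ (pts Y) ∧ ∃ M : ℝ, ∀ x ∈ pts Y, wWeight n x.1 * |ψ x| ≤ M

/-- Supremum norm over `Y × 𝕊ⁿ`. -/
def nsup {n : ℕ} {F : Type*} [NormedAddCommGroup F] (Y : Set (Euc n))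
    (f : Euc n × Euc n → F) : ℝ :=
  sSup ((fun x => ‖f x‖) '' pts Y)

/-- The set of Lipschitz constants of `f` on `Y × 𝕊ⁿ` (with the metric induced from
`ℝ^{n+1} × ℝ^{n+1}`). -/
def lipSet {n : ℕ} {F : Type*} [NormedAddCommGroup F] (Y : Set (Euc n))
    (f : Euc n × Euc n → F) : Set ℝ :=
  {K : ℝ | 0 ≤ K ∧ ∀ x ∈ pts Y, ∀ y ∈ pts Y, ‖f x - f y‖ ≤ K * dist x y}

/-- The Lipschitz norm `‖f‖_{Lip}`: sup norm plus best Lipschitz constant. -/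
def LipNorm {n : ℕ} {F : Type*} [NormedAddCommGroup F] (Y : Set (Euc n))
    (f : Euc n × Euc n → F) : ℝ :=
  nsup Y f + sInf (lipSet Y f)

/-- `f` is bounded and Lipschitz on `Y × 𝕊ⁿ`. -/
def IsBddLip {n : ℕ} {F : Type*} [NormedAddCommGroup F] (Y : Set (Euc n))
    (f : Euc n × Euc n → F) : Prop :=
  (∃ M : ℝ, ∀ x ∈ pts Y, ‖f x‖ ≤ M) ∧ (lipSet Y f).Nonempty

/-- `g` is the spherical gradient `∇_{𝕊ⁿ} ψ` on `Y × 𝕊ⁿ`: at each `(p,v) ∈ Y × 𝕊ⁿ`,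
`g(p,v)` is orthogonal to `v` and is the gradient of `ψ(p,·)` at `v` along the sphere. -/
def IsSphereGrad {n : ℕ} (Y : Set (Euc n)) (ψ : Euc n × Euc n → ℝ)
    (g : Euc n × Euc n → Euc n) : Prop :=
  ∀ x ∈ pts Y,
    ⟪g x, x.2⟫ = 0 ∧
    HasFDerivWithinAt (fun v => ψ (x.1, v)) (innerSL ℝ (g x)) (Sph n) x.2

/-- The weighted gradient supremum `sup (1+|p|)|∇_{𝕊ⁿ}ψ|`. -/
def gradWsup {n : ℕ} (Y : Set (Euc n)) (g : Euc n × Euc n → Euc n) : ℝ :=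
  sSup ((fun x => (1 + ‖x.1‖) * ‖g x‖) '' pts Y)

/-- Membership in the space 𝔛(Y). -/
def memX {n : ℕ} (Y : Set (Euc n)) (ψ : Euc n × Euc n → ℝ) : Prop :=
  IsBddLip Y ψ ∧ ∃ g : Euc n × Euc n → Euc n, IsSphereGrad Y ψ g ∧ IsBddLip Y g ∧
    ∃ M : ℝ, ∀ x ∈ pts Y, (1 + ‖x.1‖) * ‖g x‖ ≤ M

/-- The 𝔛-norm `‖ψ‖_𝔛 = ‖ψ‖_{Lip} + ‖∇_{𝕊ⁿ}ψ‖_{Lip} + sup (1+|p|)|∇_{𝕊ⁿ}ψ|`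
(as an infimum over representatives of the spherical gradient). -/
def XNorm {n : ℕ} (Y : Set (Euc n)) (ψ : Euc n × Euc n → ℝ) : ℝ :=
  sInf {r : ℝ | ∃ g : Euc n × Euc n → Euc n, IsSphereGrad Y ψ g ∧
    r = LipNorm Y ψ + LipNorm Y g + gradWsup Y g}

/-- Membership in `𝔜′(Y) = 𝔛(Y) + 𝔚(Y)` (equality of functions on `Y × 𝕊ⁿ`). -/
def memYp {n : ℕ} (Y : Set (Euc n)) (ψ : Euc n × Euc n → ℝ) : Prop :=
  ∃ ζ ξ : Euc n × Euc n → ℝ, memX Y ζ ∧ memW Y ξ ∧ ∀ x ∈ pts Y, ψ x = ζ x + ξ x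

/-- The 𝔜-norm `‖ψ‖_𝔜 = inf {‖ζ‖_𝔛 + ‖ξ‖_𝔚 : ψ = ζ + ξ}`. -/
def YNorm {n : ℕ} (Y : Set (Euc n)) (ψ : Euc n × Euc n → ℝ) : ℝ :=
  sInf {r : ℝ | ∃ ζ ξ : Euc n × Euc n → ℝ, memX Y ζ ∧ memW Y ξ ∧
    (∀ x ∈ pts Y, ψ x = ζ x + ξ x) ∧ r = XNorm Y ζ + WNorm Y ξ}

/-- Continuous compactly supported functions on `Y × 𝕊ⁿ`. -/
def memCc {n : ℕ} (Y : Set (Euc n)) (φ : Euc n × Euc n → ℝ) : Prop :=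
  ContinuousOn φ (pts Y) ∧
    ∃ K : Set (Euc n × Euc n), IsCompact K ∧ ∀ x ∈ pts Y, x ∉ K → φ x = 0

/-- Membership in `𝔜₀(Y)`: the closure of `C⁰_c(Y × 𝕊ⁿ)` in `𝔜′(Y)`. -/
def memY0 {n : ℕ} (Y : Set (Euc n)) (ψ : Euc n × Euc n → ℝ) : Prop :=
  memYp Y ψ ∧ ∀ ε : ℝ, 0 < ε → ∃ φ, memCc Y φ ∧ YNorm Y (fun x => ψ x - φ x) < ε

/-- Membership in `𝔜(Y) = ℝ·𝟙 ⊕ 𝔜₀(Y)`. -/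
def memY {n : ℕ} (Y : Set (Euc n)) (ψ : Euc n × Euc n → ℝ) : Prop :=
  ∃ (c : ℝ) (φ : Euc n × Euc n → ℝ), memY0 Y φ ∧ ∀ x ∈ pts Y, ψ x = c + φ x

lemma aux_wWeight_pos (n : ℕ) (p : Euc n) : 0 < wWeight n p := by
  unfold wWeight; positivity

lemma aux_pts_closed {n : ℕ} {Y : Set (Euc n)} (hY : IsClosed Y) : IsClosed (pts Y) :=
  hY.prod Metric.isClosed_sphere

lemma aux_wWeight_cont (n : ℕ) : Continuous (wWeight n) := by
  unfold wWeight; fun_prop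

lemma aux_Cc_memW {n : ℕ} {Y : Set (Euc n)} (hY : IsClosed Y) {φ : Euc n × Euc n → ℝ}
    (h : memCc Y φ) : memW Y φ := by
  obtain ⟨hc, K, hK, hz⟩ := h
  refine ⟨hc, ?_⟩
  have hK' : IsCompact (pts Y ∩ K) := hK.inter_left (aux_pts_closed hY)
  have hcont : ContinuousOn (fun x : Euc n × Euc n => wWeight n x.1 * |φ x|) (pts Y ∩ K) :=
    (((aux_wWeight_cont n).comp continuous_fst).continuousOn).mul
      ((hc.mono inter_subset_left).abs)
  obtain ⟨M, hM⟩ := hK'.bddAbove_image hcont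
  refine ⟨max M 0, fun x hx => ?_⟩
  by_cases hxK : x ∈ K
  · exact le_max_of_le_left (hM ⟨x, ⟨hx, hxK⟩, rfl⟩)
  · simp [hz x hx hxK]

lemma aux_nsup_nonneg {n : ℕ} {F : Type*} [NormedAddCommGroup F] (Y : Set (Euc n))
    (f : Euc n × Euc n → F) : 0 ≤ nsup Y f := by
  apply Real.sSup_nonneg
  rintro _ ⟨x, _, rfl⟩
  exact norm_nonneg _

lemma aux_LipNorm_nonneg {n : ℕ} {F : Type*} [NormedAddCommGroup F] (Y : Set (Euc n))
    (f : Euc n × Euc n → F) : 0 ≤ LipNorm Y f :=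
  add_nonneg (aux_nsup_nonneg Y f) (Real.sInf_nonneg fun _ h => h.1)

lemma aux_gradWsup_nonneg {n : ℕ} (Y : Set (Euc n))
    (g : Euc n × Euc n → Euc n) : 0 ≤ gradWsup Y g := by
  apply Real.sSup_nonneg
  rintro _ ⟨x, _, rfl⟩
  positivity

lemma aux_WNorm_nonneg {n : ℕ} (Y : Set (Euc n)) (f : Euc n × Euc n → ℝ) : 0 ≤ WNorm Y f := by
  apply Real.sSup_nonneg
  rintro _ ⟨x, _, rfl⟩
  exact mul_nonneg (aux_wWeight_pos n _).le (abs_nonneg _)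

lemma aux_Xset_nonneg {n : ℕ} (Y : Set (Euc n)) (ψ : Euc n × Euc n → ℝ) (r : ℝ)
    (h : ∃ g : Euc n × Euc n → Euc n, IsSphereGrad Y ψ g ∧
    r = LipNorm Y ψ + LipNorm Y g + gradWsup Y g) : 0 ≤ r := by
  obtain ⟨g, _, rfl⟩ := h
  have := aux_LipNorm_nonneg Y ψ
  have := aux_LipNorm_nonneg Y g
  have := aux_gradWsup_nonneg Y g
  positivity

lemma aux_XNorm_nonneg {n : ℕ} (Y : Set (Euc n)) (f : Euc n × Euc n → ℝ) : 0 ≤ XNorm Y f :=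
  Real.sInf_nonneg (aux_Xset_nonneg Y f)

lemma aux_YNorm_le {n : ℕ} {Y : Set (Euc n)} {ψ ζ ξ : Euc n × Euc n → ℝ} (hζ : memX Y ζ)
    (hξ : memW Y ξ) (h : ∀ x ∈ pts Y, ψ x = ζ x + ξ x) :
    YNorm Y ψ ≤ XNorm Y ζ + WNorm Y ξ := by
  apply csInf_le
  · refine ⟨0, ?_⟩
    rintro _ ⟨ζ, ξ, _, _, _, rfl⟩
    exact add_nonneg (aux_XNorm_nonneg Y ζ) (aux_WNorm_nonneg Y ξ)
  · exact ⟨ζ, ξ, hζ, hξ, h, rfl⟩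

lemma aux_lipSet_add {n : ℕ} (Y : Set (Euc n)) (f : Euc n × Euc n → ℝ) (c : ℝ) :
    lipSet Y (fun x => f x + c) = lipSet Y f := by
  unfold lipSet; simp

lemma aux_grad_add {n : ℕ} {Y : Set (Euc n)} {f : Euc n × Euc n → ℝ}
    {g : Euc n × Euc n → Euc n} (c : ℝ) (h : IsSphereGrad Y f g) :
    IsSphereGrad Y (fun x => f x + c) g :=
  fun x hx => ⟨(h x hx).1, (h x hx).2.add_const c⟩

lemma aux_memX_add {n : ℕ} {Y : Set (Euc n)} {f : Euc n × Euc n → ℝ} (c : ℝ)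
    (h : memX Y f) : memX Y (fun x => f x + c) := by
  obtain ⟨⟨⟨M, hM⟩, hl⟩, g, hg, h2⟩ := h
  refine ⟨⟨⟨M + |c|, fun x hx => ?_⟩, ?_⟩, g, aux_grad_add c hg, h2⟩
  · exact (norm_add_le _ _).trans (add_le_add (hM x hx) le_rfl)
  · rw [aux_lipSet_add]; exact hl

lemma aux_nsup_add {n : ℕ} {Y : Set (Euc n)} {f : Euc n × Euc n → ℝ} (c : ℝ)
    (h : ∃ M : ℝ, ∀ x ∈ pts Y, ‖f x‖ ≤ M) : nsup Y (fun x => f x + c) ≤ nsup Y f + |c| := by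
  obtain ⟨M, hM⟩ := h
  apply Real.sSup_le
  · rintro _ ⟨x, hx, rfl⟩
    refine (norm_add_le _ _).trans (add_le_add ?_ le_rfl)
    refine le_csSup ⟨M, ?_⟩ ⟨x, hx, rfl⟩
    rintro _ ⟨y, hy, rfl⟩
    exact hM y hy
  · exact add_nonneg (aux_nsup_nonneg Y f) (abs_nonneg c)

lemma aux_XNorm_add {n : ℕ} {Y : Set (Euc n)} {f : Euc n × Euc n → ℝ} (c : ℝ)
    (h : memX Y f) : XNorm Y (fun x => f x + c) ≤ XNorm Y f + |c| := by
  rw [← sub_le_iff_le_add]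
  obtain ⟨⟨hM, hl⟩, g, hg, h2⟩ := h
  refine le_csInf (Set.nonempty_of_mem ⟨g, hg, rfl⟩) ?_
  rintro _ ⟨g, hg, rfl⟩
  rw [sub_le_iff_le_add]
  refine (csInf_le ⟨0, fun r hr => aux_Xset_nonneg Y _ r hr⟩
    ⟨g, aux_grad_add c hg, rfl⟩).trans ?_
  have := aux_nsup_add c hM
  have h3 : LipNorm Y (fun x => f x + c) ≤ LipNorm Y f + |c| := by
    unfold LipNorm; rw [aux_lipSet_add]; linarith
  linarith

lemma aux_lipSet_zero {n : ℕ} {F : Type*} [NormedAddCommGroup F] (Y : Set (Euc n)) :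
    (0 : ℝ) ∈ lipSet Y (fun _ => (0 : F)) := by
  simp [lipSet]

lemma aux_LipNorm_zero {n : ℕ} {F : Type*} [NormedAddCommGroup F] (Y : Set (Euc n)) :
    LipNorm Y (fun _ => (0 : F)) ≤ 0 := by
  have h1 : nsup Y (fun _ => (0 : F)) ≤ 0 := by
    apply Real.sSup_le _ le_rfl
    rintro _ ⟨x, _, rfl⟩
    simp
  have h2 : sInf (lipSet Y (fun _ => (0 : F))) ≤ 0 :=
    csInf_le ⟨0, fun _ h => h.1⟩ (aux_lipSet_zero Y)
  unfold LipNorm; linarith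

lemma aux_grad_zero {n : ℕ} (Y : Set (Euc n)) :
    IsSphereGrad Y (fun _ => (0 : ℝ)) (fun _ => 0) := by
  intro x hx
  refine ⟨inner_zero_left _, ?_⟩
  simpa using hasFDerivWithinAt_const (0 : ℝ) x.2 (Sph n)

lemma aux_memX_zero {n : ℕ} (Y : Set (Euc n)) : memX Y (fun _ => 0) :=
  ⟨⟨⟨0, by simp⟩, 0, aux_lipSet_zero Y⟩, fun _ => 0, aux_grad_zero Y,
    ⟨⟨0, by simp⟩, 0, aux_lipSet_zero Y⟩, 0, by simp⟩

lemma aux_XNorm_zero {n : ℕ} (Y : Set (Euc n)) : XNorm Y (fun _ => 0) ≤ 0 := by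
  refine (csInf_le ⟨0, fun r hr => aux_Xset_nonneg Y _ r hr⟩
    ⟨fun _ => 0, aux_grad_zero Y, rfl⟩).trans ?_
  have h1 := aux_LipNorm_zero (F := ℝ) Y
  have h2 := aux_LipNorm_zero (F := Euc n) Y
  have h3 : gradWsup Y (fun _ => (0 : Euc n)) ≤ 0 := by
    apply Real.sSup_le _ le_rfl
    rintro _ ⟨x, _, rfl⟩
    simp
  linarith

lemma aux_WNorm_zero {n : ℕ} (Y : Set (Euc n)) : WNorm Y (fun _ => 0) ≤ 0 := by
  apply Real.sSup_le _ le_rfl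
  rintro _ ⟨x, _, rfl⟩
  simp

lemma aux_memW_zero {n : ℕ} (Y : Set (Euc n)) : memW Y (fun _ => 0) :=
  ⟨continuousOn_const, 0, by simp⟩

lemma aux_memW_add {n : ℕ} {Y : Set (Euc n)} {f g : Euc n × Euc n → ℝ} (hf : memW Y f)
    (hg : memW Y g) : memW Y (fun x => f x + g x) := by
  obtain ⟨cf, M, hM⟩ := hf
  obtain ⟨cg, N, hN⟩ := hg
  refine ⟨cf.add cg, M + N, fun x hx => ?_⟩
  have h1 := mul_le_mul_of_nonneg_left (abs_add_le (f x) (g x)) (aux_wWeight_pos n x.1).le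
  linarith [hM x hx, hN x hx]

lemma aux_memW_neg {n : ℕ} {Y : Set (Euc n)} {f : Euc n × Euc n → ℝ} (hf : memW Y f) :
    memW Y (fun x => - f x) :=
  ⟨hf.1.neg, by simpa using hf.2⟩

lemma aux_WNorm_add {n : ℕ} {Y : Set (Euc n)} {f g : Euc n × Euc n → ℝ} (hf : memW Y f)
    {ε : ℝ} (hε : 0 ≤ ε) (hg : ∀ x ∈ pts Y, wWeight n x.1 * |g x| ≤ ε) :
    WNorm Y (fun x => f x + g x) ≤ WNorm Y f + ε := by
  obtain ⟨cf, M, hM⟩ := hf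
  apply Real.sSup_le _ (add_nonneg (aux_WNorm_nonneg Y f) hε)
  rintro _ ⟨x, hx, rfl⟩
  have h1 := mul_le_mul_of_nonneg_left (abs_add_le (f x) (g x)) (aux_wWeight_pos n x.1).le
  have h2 : wWeight n x.1 * |f x| ≤ WNorm Y f := by
    refine le_csSup ⟨M, ?_⟩ ⟨x, hx, rfl⟩
    rintro _ ⟨y, hy, rfl⟩
    exact hM y hy
  simp only
  linarith [hg x hx]

lemma aux_memY0_of_Cc {n : ℕ} {Y : Set (Euc n)} (hY : IsClosed Y) {φ : Euc n × Euc n → ℝ}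
    (h : memCc Y φ) : memY0 Y φ := by
  refine ⟨⟨fun _ => 0, φ, aux_memX_zero Y, aux_Cc_memW hY h, by simp⟩, fun ε hε => ⟨φ, h, ?_⟩⟩
  have := aux_YNorm_le (ψ := fun x => φ x - φ x) (aux_memX_zero Y) (aux_memW_zero Y) (by simp)
  linarith [aux_XNorm_zero Y, aux_WNorm_zero Y]

lemma aux_dense_N {n : ℕ} {Y : Set (Euc n)} (K : Set (Euc n × Euc n)) (hK : IsCompact K)
    (hKY : K ⊆ pts Y) :
    ∃ D : Set (Euc n × Euc n → ℝ), D.Countable ∧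
      (∀ d ∈ D, ContinuousOn d (pts Y) ∧ ∀ x ∈ pts Y, x ∉ K → d x = 0) ∧
      ∀ φ, ContinuousOn φ (pts Y) → (∀ x ∈ pts Y, x ∉ K → φ x = 0) → ∀ ε : ℝ, 0 < ε →
        ∃ d ∈ D, ∀ x ∈ pts Y, wWeight n x.1 * |φ x - d x| ≤ ε := by
  haveI : CompactSpace K := isCompact_iff_compactSpace.mp hK
  let A := {φ : Euc n × Euc n → ℝ // ContinuousOn φ (pts Y) ∧ ∀ x ∈ pts Y, x ∉ K → φ x = 0}
  let R : A → C(K, ℝ) := fun φ => ⟨K.restrict φ.1, (φ.2.1.mono hKY).restrict⟩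
  obtain ⟨t, htR, htc, htd⟩ := (TopologicalSpace.IsSeparable.of_separableSpace
    (range R)).exists_countable_dense_subset
  have : Nonempty A := ⟨⟨fun _ => 0, continuousOn_const, by simp⟩⟩
  choose! s hs using fun f (hf : f ∈ t) => htR hf
  refine ⟨(fun f => (s f).1) '' t, htc.image _, ?_, ?_⟩
  · rintro _ ⟨f, _, rfl⟩
    exact (s f).2
  · intro φ hφ hz ε hε
    obtain ⟨M, hM⟩ := hK.bddAbove_image
      (((aux_wWeight_cont n).comp continuous_fst).continuousOn (s := K))
    have hM1 : 0 < |M| + 1 := by positivity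
    obtain ⟨f, hft, hf⟩ := Metric.mem_closure_iff.mp (htd ⟨⟨φ, hφ, hz⟩, rfl⟩)
      (ε / (|M| + 1)) (by positivity)
    refine ⟨_, ⟨f, hft, rfl⟩, fun x hx => ?_⟩
    by_cases hxK : x ∈ K
    · rw [← hs f hft] at hf
      have h1 := (ContinuousMap.dist_apply_le_dist (⟨x, hxK⟩ : K)).trans hf.le
      have h2 : |φ x - (s f).1 x| ≤ ε / (|M| + 1) := h1
      have h3 : wWeight n x.1 ≤ |M| + 1 := by
        have : wWeight n x.1 ≤ M := hM ⟨x, hxK, rfl⟩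
        linarith [le_abs_self M]
      calc _ ≤ (|M| + 1) * (ε / (|M| + 1)) := by gcongr
        _ = ε := by field_simp
    · simp [hz x hx hxK, (s f).2.2 x hx hxK, hε.le]

lemma aux_dense_Cc {n : ℕ} {Y : Set (Euc n)} (hY : IsClosed Y) :
    ∃ D : Set (Euc n × Euc n → ℝ), D.Countable ∧ (∀ d ∈ D, memCc Y d) ∧
      ∀ φ, memCc Y φ → ∀ ε : ℝ, 0 < ε →
        ∃ d ∈ D, ∀ x ∈ pts Y, wWeight n x.1 * |φ x - d x| ≤ ε := by
  have hK : ∀ N : ℕ, IsCompact (pts Y ∩ Metric.closedBall (0 : Euc n × Euc n) N) :=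
    fun N => (isCompact_closedBall _ _).inter_left (aux_pts_closed hY)
  choose D hDc hDm hDd using fun N => aux_dense_N _ (hK N) inter_subset_left
  refine ⟨⋃ N, D N, countable_iUnion hDc, ?_, ?_⟩
  · intro d hd
    obtain ⟨N, hN⟩ := mem_iUnion.mp hd
    exact ⟨(hDm N d hN).1, _, hK N, (hDm N d hN).2⟩
  · rintro φ ⟨hc, K, hKc, hz⟩ ε hε
    obtain ⟨r, hr⟩ := hKc.isBounded.subset_closedBall (0 : Euc n × Euc n)
    obtain ⟨N, hN⟩ := exists_nat_ge r
    obtain ⟨d, hd, h⟩ := hDd N φ hc (fun x hx hxN => hz x hx fun hxK =>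
      hxN ⟨hx, Metric.closedBall_subset_closedBall hN (hr hxK)⟩) ε hε
    exact ⟨d, mem_iUnion.mpr ⟨N, hd⟩, h⟩

/-- For `n ≥ 2` and `Y ⊆ ℝ^{n+1}` unbounded and closed, the normed space
`(𝔜(Y), ‖·‖_𝔜)` is separable: there is a countable subset of `𝔜(Y)` that is dense in
`𝔜(Y)` for the 𝔜-norm. -/
theorem YSpace_separable
    (n : ℕ) (hn : 2 ≤ n) (Y : Set (Euc n)) (hYclosed : IsClosed Y)
    (hYunbounded : ¬ Bornology.IsBounded Y) :
    ∃ D : Set (Euc n × Euc n → ℝ), D.Countable ∧ (∀ φ ∈ D, memY Y φ) ∧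
      ∀ ψ, memY Y ψ → ∀ ε : ℝ, 0 < ε →
        ∃ φ ∈ D, YNorm Y (fun x => ψ x - φ x) < ε := by
  obtain ⟨D, hDc, hDm, hDd⟩ := aux_dense_Cc hYclosed
  refine ⟨(fun a : ℚ × (Euc n × Euc n → ℝ) => fun x => (a.1 : ℝ) + a.2 x) '' (univ ×ˢ D),
    (countable_univ.prod hDc).image _, ?_, ?_⟩
  · rintro _ ⟨⟨q, d⟩, ⟨_, hd⟩, rfl⟩
    exact ⟨q, d, aux_memY0_of_Cc hYclosed (hDm d hd), fun x _ => rfl⟩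
  · rintro ψ ⟨c, φ₀, ⟨⟨ζ₀, ξ₀, hζ₀, hξ₀, he₀⟩, h₀⟩, hψ⟩ ε hε
    obtain ⟨φ, hφ, hlt⟩ := h₀ (ε / 4) (by positivity)
    obtain ⟨d, hd, hdφ⟩ := hDd φ hφ (ε / 4) (by positivity)
    obtain ⟨q, hq1, hq2⟩ := exists_rat_btwn (show c - ε / 4 < c by linarith)
    have hW := aux_Cc_memW hYclosed hφ
    have hWd := aux_Cc_memW hYclosed (hDm d hd)
    unfold YNorm at hlt
    obtain ⟨_, ⟨ζ, ξ, hζ, hξ, he, rfl⟩, hr⟩ := (fun h => exists_lt_of_csInf_lt h hlt)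
      (Set.nonempty_of_mem ⟨ζ₀, fun x => ξ₀ x + - φ x, hζ₀, aux_memW_add hξ₀ (aux_memW_neg hW),
        fun x hx => by beta_reduce; rw [he₀ x hx]; ring, rfl⟩)
    refine ⟨_, ⟨⟨q, d⟩, ⟨mem_univ _, hd⟩, rfl⟩, ?_⟩
    have h1 := aux_YNorm_le (ψ := fun x => ψ x - ((q : ℝ) + d x))
      (aux_memX_add (c - q) hζ)
      (aux_memW_add hξ (aux_memW_add hW (aux_memW_neg hWd)))
      (fun x hx => by have := he x hx; beta_reduce at this ⊢; rw [hψ x hx]; linarith)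
    have h2 := aux_XNorm_add (c - q) hζ
    have h3 := aux_WNorm_add (g := fun x => φ x + - d x) hξ (ε := ε / 4) (by positivity)
      (fun x hx => by simpa [← sub_eq_add_neg] using hdφ x hx)
    have h4 : |c - q| ≤ ε / 4 := by rw [abs_le]; constructor <;> linarith
    refine lt_of_le_of_lt h1 ?_
    linarith
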